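/- arXiv:2312.11077 — 2 statements merged into one kernel-verified Lean document; each statement's English description precedes it below -/
import Mathlib

section
/- Let (R, 𝔪) be a two-dimensional regular local ring with infinite residue field. Suppose I is an integrally closed 𝔪-primary ideal of order r whose image in 𝔪^r/𝔪^{r+1} spans a subspace of dimension at least 2 over the residue field. If I = I(M) for an integrally closed finitely generated torsion-free R-module M of rank r without free direct summands, then 𝔪 is a direct summand of M. -/
open IsLocalRing

section Defs

variable {R : Type*} [CommRing R]

/-- `R` is a two-dimensional regular local ring: Noetherian local of Krull dimension 2
whose maximal ideal is generated by two elements. -/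
def IsTwoDimRegularLocal (R : Type*) [CommRing R] [IsLocalRing R] : Prop :=
  IsNoetherianRing R ∧ ringKrullDim R = 2 ∧
    ∃ x y : R, maximalIdeal R = Ideal.span {x, y}

/-- `z` lies in the integral closure of the ideal `I`, i.e. it satisfies an equation
`z ^ n + c 1 * z ^ (n-1) + ⋯ + c n = 0` with `c i ∈ I ^ i`. -/
def MemIntClosure (I : Ideal R) (z : R) : Prop :=
  ∃ n : ℕ, 0 < n ∧ ∃ c : ℕ → R, (∀ i ∈ Finset.Icc 1 n, c i ∈ I ^ i) ∧
    z ^ n + ∑ i ∈ Finset.Icc 1 n, c i * z ^ (n - i) = 0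

/-- The ideal `I` is integrally closed. -/
def IdealIntClosed (I : Ideal R) : Prop := ∀ z, MemIntClosure I z → z ∈ I

/-- `I` is `𝔪`-primary. -/
def IsMPrimary [IsLocalRing R] (I : Ideal R) : Prop := I.radical = maximalIdeal R

/-- `ord I = n` : `n` is the largest power of the maximal ideal containing `I`. -/
def ordEQ [IsLocalRing R] (I : Ideal R) (n : ℕ) : Prop :=
  I ≤ maximalIdeal R ^ n ∧ ¬ I ≤ maximalIdeal R ^ (n + 1)

/-- Determinant of the square matrix with columns `w 0, …, w (r-1)`. -/
def colDet {r : ℕ} (w : Fin r → Fin r → R) : R :=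
  Matrix.det (Matrix.of fun i j => w j i)

/-- The ideal of maximal minors `I(M)` of a submodule `M ⊆ R^r`:  it is generated by all
determinants of `r × r` matrices whose columns lie in `M`. -/
def maxMinors {r : ℕ} (M : Submodule R (Fin r → R)) : Ideal R :=
  Ideal.span { d | ∃ w : Fin r → Fin r → R, (∀ j, w j ∈ M) ∧ d = colDet w }

/-- The ideal `I_k(M)` of `k × k` minors of a matrix whose columns generate `M ⊆ R^r`. -/
def minorsIdeal (k : ℕ) {r : ℕ} (M : Submodule R (Fin r → R)) : Ideal R :=
  Ideal.span { d | ∃ (w : Fin k → Fin r → R) (ρ : Fin k → Fin r),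
    Function.Injective ρ ∧ (∀ j, w j ∈ M) ∧
    d = Matrix.det (Matrix.of fun i j : Fin k => w j (ρ i)) }

/-- `v ∈ R^r` is integral over the submodule `M ⊆ R^r` : the determinant of every square
matrix with one column `v` and the remaining columns in `M` is integral over `I(M)`. -/
def IntegralOverMod {r : ℕ} (M : Submodule R (Fin r → R)) (v : Fin r → R) : Prop :=
  ∀ (w : Fin r → Fin r → R) (j₀ : Fin r), w j₀ = v → (∀ j, j ≠ j₀ → w j ∈ M) →
    MemIntClosure (maxMinors M) (colDet w)

/-- The submodule `M ⊆ R^r` is integrally closed. -/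
def ModIntClosed {r : ℕ} (M : Submodule R (Fin r → R)) : Prop :=
  ∀ v, IntegralOverMod M v → v ∈ M

/-- The length of an `R`-module, as the Krull dimension of its submodule lattice. -/
noncomputable def modLength (R : Type*) (M : Type*) [CommRing R] [AddCommGroup M]
    [Module R M] : WithBot ℕ∞ :=
  Order.krullDim (Submodule R M)

/-- `M ⊆ R^r` has finite colength; equivalently, `M` is a finitely generated torsion-free
module of rank `r` with double dual `M** = R^r`. -/
def FinColength {r : ℕ} (M : Submodule R (Fin r → R)) : Prop :=
  IsFiniteLength R ((Fin r → R) ⧸ M)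

/-- `M` has a nonzero free direct summand. -/
def HasFreeSummand {r : ℕ} (M : Submodule R (Fin r → R)) : Prop :=
  ∃ N P : Submodule R (Fin r → R), N ⊔ P = M ∧ N ⊓ P = ⊥ ∧ N ≠ ⊥ ∧ Module.Free R ↥N

/-- `M` is a direct sum of two nonzero submodules. -/
def DecomposableSub {r : ℕ} (M : Submodule R (Fin r → R)) : Prop :=
  ∃ N P : Submodule R (Fin r → R), N ⊔ P = M ∧ N ⊓ P = ⊥ ∧ N ≠ ⊥ ∧ P ≠ ⊥

/-- `M` is nonzero and not a direct sum of two nonzero submodules. -/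
def IndecomposableSub {r : ℕ} (M : Submodule R (Fin r → R)) : Prop :=
  M ≠ ⊥ ∧ ¬ DecomposableSub M

/-- `a` is a minimal generating set of the ideal `I`. -/
def MinGens {m : ℕ} (I : Ideal R) (a : Fin m → R) : Prop :=
  Ideal.span (Set.range a) = I ∧ ∀ j : Fin m, Ideal.span (a '' {j}ᶜ) ≠ I

/-- `a = c 0 * x^(r-1) + c 1 * x^(r-2) * y + ⋯ + c (r-1) * y^(r-1)`. -/
def Expresses (r : ℕ) (x y : R) (c : Fin r → R) (a : R) : Prop :=
  a = ∑ i : Fin r, c i * x ^ (r - 1 - (i : ℕ)) * y ^ (i : ℕ)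

/-- The `k`-th Koszul relation column between `x^(r-1), …, y^(r-1)`:
`y` in position `k` and `-x` in position `k+1`. -/
def stdRelCol (r : ℕ) (x y : R) (k : ℕ) : Fin r → R :=
  fun i => if (i : ℕ) = k then y else if (i : ℕ) = k + 1 then -x else 0

/-- The module generated by the coefficient columns `C j` together with the `r - 1`
Koszul relation columns between `x^(r-1), …, y^(r-1)`. -/
def MrSpan (r : ℕ) (x y : R) {m : ℕ} (C : Fin m → Fin r → R) :
    Submodule R (Fin r → R) :=
  Submodule.span R (Set.range C ∪ { v | ∃ k, k < r - 1 ∧ v = stdRelCol r x y k })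

/-- The data `(x, y, a, C)` presents the module `M_r(I)` : `𝔪 = (x,y)`, `a` is a minimal
generating set of `I` and column `C j` expresses `a j` in terms of `x^(r-1), …, y^(r-1)`. -/
def IsMrPresentation [IsLocalRing R] (r : ℕ) (I : Ideal R) {m : ℕ} (x y : R)
    (a : Fin m → R) (C : Fin m → Fin r → R) : Prop :=
  maximalIdeal R = Ideal.span {x, y} ∧ MinGens I a ∧ ∀ j, Expresses r x y (C j) (a j)

/-- `N` is a reduction of `M` : `N ≤ M` and every element of `M` is integral over `N`. -/
def IsReductionMod {r : ℕ} (N M : Submodule R (Fin r → R)) : Prop :=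
  N ≤ M ∧ ∀ v ∈ M, IntegralOverMod N v

/-- `N` is a minimal reduction of `M`. -/
def IsMinimalReductionMod {r : ℕ} (N M : Submodule R (Fin r → R)) : Prop :=
  IsReductionMod N M ∧ ∀ N' ≤ N, IsReductionMod N' M → N' = N

/-- The `j`-th signed maximal minor of an `r × (r+1)` matrix. -/
def signedMinor {r : ℕ} (A : Matrix (Fin r) (Fin (r + 1)) R) (j : Fin (r + 1)) : R :=
  (-1 : R) ^ (j : ℕ) * (A.submatrix id j.succAbove).det

/-- `M ⊆ R^r` is extremal: integrally closed, without free direct summands, with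
`λ(R/I(M)) = λ(R^r/M) + r(r-1)/2`. -/
def IsExtremal {r : ℕ} (M : Submodule R (Fin r → R)) : Prop :=
  FinColength M ∧ ModIntClosed M ∧ ¬ HasFreeSummand M ∧
    modLength R (R ⧸ maxMinors M) =
      modLength R ((Fin r → R) ⧸ M) + ((r * (r - 1) / 2 : ℕ) : WithBot ℕ∞)

/-- `a ∈ J`, `b ∈ K` is a joint reduction of the pair `(J, K)`. -/
def IsJointReduction (J K : Ideal R) (a b : R) : Prop :=
  a ∈ J ∧ b ∈ K ∧ ∃ n : ℕ,
    (Ideal.span {a} * K + Ideal.span {b} * J) * (J * K) ^ n = (J * K) ^ (n + 1)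

/-- `S` is the matrix `Sym^k(Q)` for `Q = [[a, c], [b, d]]` : with `X = aU + bV`,
`Y = cU + dV`, the `j`-th column of `S` records the coefficients of
`X^(k-j) Y^j` in terms of `U^k, U^(k-1)V, …, V^k`. -/
def IsSymOf (k : ℕ) (a b c d : R) (S : Matrix (Fin (k + 1)) (Fin (k + 1)) R) : Prop :=
  ∀ j : Fin (k + 1),
    ((MvPolynomial.C a * MvPolynomial.X 0 + MvPolynomial.C b * MvPolynomial.X 1) ^ (k - (j : ℕ)) *
        (MvPolynomial.C c * MvPolynomial.X 0 + MvPolynomial.C d * MvPolynomial.X 1) ^ (j : ℕ)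
      : MvPolynomial (Fin 2) R)
    = ∑ i : Fin (k + 1), MvPolynomial.C (S i j) *
        MvPolynomial.X 0 ^ (k - (i : ℕ)) * MvPolynomial.X 1 ^ (i : ℕ)

/-- The `r × s` bidiagonal matrix with `y` on the diagonal and `-x` directly below it. -/
def bidiag (r s : ℕ) (x y : R) : Matrix (Fin r) (Fin s) R :=
  Matrix.of fun i j =>
    if (i : ℕ) = (j : ℕ) then y else if (i : ℕ) = (j : ℕ) + 1 then -x else 0

end Defs

section Helpers

variable {R : Type*} [CommRing R]

theorem memIntClosure_of_mul_mem_mul {I K : Ideal R} (hK : K.FG) {z : R} {n : ℕ}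
    (hz : z ^ n ∈ K) (h : ∀ k ∈ K, z * k ∈ I * K) : MemIntClosure I z := by
  have : Module.Finite R K := Module.Finite.iff_fg.mpr hK
  obtain ⟨p, hp, -, hc, h0⟩ :=
    LinearMap.exists_monic_and_natDegree_eq_and_coeff_mem_pow_and_aeval_eq_zero R
      (algebraMap R (Module.End R K) z) I (by
        rintro _ ⟨k, rfl⟩
        rw [Submodule.mem_smul_top_iff]
        simpa using h k k.2)
  have hpz : p.eval z * z ^ n = 0 := by
    rw [Polynomial.aeval_algebraMap_apply] at h0
    have := congrArg Subtype.val (LinearMap.congr_fun h0 ⟨z ^ n, hz⟩)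
    simpa [Polynomial.aeval_def] using this
  refine ⟨p.natDegree + n + 1, by omega,
    fun i => if i ≤ p.natDegree then p.coeff (p.natDegree - i) else 0, ?_, ?_⟩
  · intro i hi
    dsimp only
    split_ifs with hle
    · have := hc (p.natDegree - i)
      rwa [Nat.sub_sub_self hle] at this
    · exact zero_mem _
  · have hsum : z ^ (p.natDegree + n + 1) + ∑ i ∈ Finset.Icc 1 (p.natDegree + n + 1),
        (if i ≤ p.natDegree then p.coeff (p.natDegree - i) else 0) *
          z ^ (p.natDegree + n + 1 - i) = p.eval z * z ^ n * z := by
      have h1 : ∑ i ∈ Finset.Icc 1 (p.natDegree + n + 1),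
          (if i ≤ p.natDegree then p.coeff (p.natDegree - i) else 0) *
            z ^ (p.natDegree + n + 1 - i) =
          ∑ i ∈ Finset.range p.natDegree, p.coeff i * z ^ i * (z ^ n * z) := by
        symm
        rw [← Finset.sum_range_reflect]
        refine Finset.sum_of_injOn (fun i => i + 1) ?_ ?_ ?_ ?_
        · intro a _ b _ hab
          simpa using hab
        · intro a ha
          simp only [Finset.coe_range, Set.mem_Iio, Finset.coe_Icc, Set.mem_Icc] at ha ⊢
          omega
        · intro i hi hi'
          rw [if_neg, zero_mul]
          intro hle
          refine hi' ⟨i - 1, ?_, ?_⟩ <;>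
            simp only [Finset.coe_range, Set.mem_Iio, Finset.mem_Icc] at hi ⊢ <;> omega
        · intro i hi
          rw [Finset.mem_range] at hi
          rw [if_pos (by omega), mul_assoc, ← pow_succ, ← pow_add]
          congr 2 <;> omega
      rw [h1, Polynomial.eval_eq_sum_range, Finset.sum_range_succ, hp.coeff_natDegree,
        ← Finset.sum_mul]
      ring
    rw [hsum, hpz, zero_mul]

theorem span_pair_pow_succ_le (x y : R) (n : ℕ) :
    Ideal.span {x, y} ^ (n + 1) ≤
      Ideal.span {x} * Ideal.span {x, y} ^ n ⊔ Ideal.span {y ^ (n + 1)} := by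
  induction n with
  | zero => simp [Ideal.span_insert]
  | succ n ih =>
    have hy : Ideal.span {x, y} = Ideal.span {x} ⊔ Ideal.span {y} := by
      rw [Ideal.span_insert]
    have hle : Ideal.span {y} ≤ Ideal.span {x, y} := hy ▸ le_sup_right
    calc Ideal.span {x, y} ^ (n + 1 + 1)
        = Ideal.span {x} * Ideal.span {x, y} ^ (n + 1) ⊔
            Ideal.span {y} * Ideal.span {x, y} ^ (n + 1) := by
          rw [pow_succ' _ (n + 1), ← Ideal.sup_mul, ← hy]
      _ ≤ _ := by
          refine sup_le le_sup_left ((Ideal.mul_mono_right ih).trans ?_)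
          rw [Ideal.mul_sup, Ideal.span_singleton_mul_span_singleton, ← pow_succ' y]
          refine sup_le_sup_right ?_ _
          rw [mul_left_comm, pow_succ' _ n]
          exact Ideal.mul_mono_right (Ideal.mul_mono_left hle)

theorem exists_sum_of_mem_span_pair_pow (x y : R) (n : ℕ) {f : R}
    (hf : f ∈ Ideal.span {x, y} ^ n) :
    ∃ c : ℕ → R, f = ∑ i ∈ Finset.range (n + 1), c i * (x ^ i * y ^ (n - i)) := by
  induction n generalizing f with
  | zero => exact ⟨fun _ => f, by simp⟩
  | succ n ih =>
    obtain ⟨g, hg, h, hh, rfl⟩ := Submodule.mem_sup.mp (span_pair_pow_succ_le x y n hf)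
    obtain ⟨g, hg', rfl⟩ := Ideal.mem_span_singleton_mul.mp hg
    obtain ⟨d, rfl⟩ := Ideal.mem_span_singleton.mp hh
    obtain ⟨c, rfl⟩ := ih hg'
    refine ⟨fun i => Nat.casesOn i d c, ?_⟩
    rw [Finset.sum_range_succ' _ (n + 1), Finset.mul_sum]
    congr 1
    · refine Finset.sum_congr rfl fun i _ => ?_
      rw [Nat.add_sub_add_right]
      ring
    · simp [mul_comm]

theorem prod_sub_prod_mem {J K : Ideal R} (n : ℕ) (a b : Fin (n + 1) → R)
    (ha : ∀ i, a i ∈ K) (hb : ∀ i, b i ∈ K) (hab : ∀ i, a i - b i ∈ J) :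
    ∏ i, a i - ∏ i, b i ∈ J * K ^ n := by
  induction n with
  | zero => simpa using hab 0
  | succ n ih =>
    rw [Fin.prod_univ_succ a, Fin.prod_univ_succ b]
    have e : a 0 * ∏ i : Fin (n + 1), a i.succ - b 0 * ∏ i : Fin (n + 1), b i.succ =
        a 0 * (∏ i : Fin (n + 1), a i.succ - ∏ i : Fin (n + 1), b i.succ) +
          (a 0 - b 0) * ∏ i : Fin (n + 1), b i.succ := by ring
    rw [e]
    refine add_mem ?_ (Ideal.mul_mem_mul (hab 0) ?_)
    · rw [pow_succ', mul_left_comm]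
      exact Ideal.mul_mem_mul (ha 0) (ih _ _ (fun i => ha _) (fun i => hb _) fun i => hab _)
    · simpa using Ideal.prod_mem_prod (s := Finset.univ) (I := fun _ : Fin (n + 1) => K)
        fun i _ => hb i.succ

theorem det_sub_det_mem {J K : Ideal R} {n : ℕ} (A B : Matrix (Fin (n + 1)) (Fin (n + 1)) R)
    (hA : ∀ i j, A i j ∈ K) (hB : ∀ i j, B i j ∈ K) (hAB : ∀ i j, A i j - B i j ∈ J) :
    A.det - B.det ∈ J * K ^ n := by
  rw [Matrix.det_apply', Matrix.det_apply', ← Finset.sum_sub_distrib]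
  refine sum_mem fun σ _ => ?_
  rw [← mul_sub]
  exact Ideal.mul_mem_left _ _ (prod_sub_prod_mem n _ _ (fun i => hA _ _) (fun i => hB _ _)
    fun i => hAB _ _)

theorem colDet_eq_det {r : ℕ} (w : Fin r → Fin r → R) : colDet w = (Matrix.of w).det :=
  Matrix.det_transpose _

theorem colDet_update_smul {r : ℕ} (w : Fin r → Fin r → R) (j : Fin r) (c : R)
    (v : Fin r → R) :
    colDet (Function.update w j (c • v)) = c * colDet (Function.update w j v) := by
  rw [colDet_eq_det, colDet_eq_det]
  exact Matrix.det_updateRow_smul _ _ _ _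

theorem colDet_update_mem_pow {K : Ideal R} {n : ℕ} (w : Fin (n + 1) → Fin (n + 1) → R)
    (j : Fin (n + 1)) (v : Fin (n + 1) → R) (hw : ∀ l, l ≠ j → ∀ i, w l i ∈ K) :
    colDet (Function.update w j v) ∈ K ^ n := by
  rw [colDet_eq_det, Matrix.det_succ_row _ j]
  refine sum_mem fun i _ => Ideal.mul_mem_left _ _ ?_
  rw [Matrix.det_apply']
  refine sum_mem fun σ _ => Ideal.mul_mem_left _ _ ?_
  have := Ideal.prod_mem_prod (s := Finset.univ) (I := fun _ : Fin n => K)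
    (x := fun l => (Matrix.of (Function.update w j v)).submatrix j.succAbove i.succAbove (σ l) l)
    fun l _ => by
      have hne : j.succAbove (σ l) ≠ j := Fin.succAbove_ne _ _
      simpa [Function.update_of_ne hne] using hw _ hne _
  simpa using this

theorem exists_sup_eq_inf_eq_bot_equiv {r : ℕ} (M : Submodule R (Fin r → R)) (J : Ideal R)
    {v : Fin r → R} {i : Fin r} (hv : IsUnit (v i)) (hJv : ∀ c ∈ J, c • v ∈ M)
    (hM : ∀ m ∈ M, m i ∈ J) :
    ∃ N P : Submodule R (Fin r → R), N ⊔ P = M ∧ N ⊓ P = ⊥ ∧ Nonempty (↥N ≃ₗ[R] ↥J) := by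
  obtain ⟨u, hu⟩ := hv.exists_left_inv
  have hinj : Function.Injective (LinearMap.toSpanSingleton R (Fin r → R) v) := by
    intro a b hab
    have h := congrFun hab i
    simp only [LinearMap.toSpanSingleton_apply, Pi.smul_apply, smul_eq_mul] at h
    exact hv.mul_right_cancel h
  refine ⟨Submodule.map (LinearMap.toSpanSingleton R (Fin r → R) v) J,
    M ⊓ LinearMap.ker (LinearMap.proj i), le_antisymm (sup_le ?_ inf_le_left) ?_, ?_,
    ⟨(Submodule.equivMapOfInjective _ hinj J).symm⟩⟩
  · rintro _ ⟨c, hc, rfl⟩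
    exact hJv c hc
  · intro m hm
    have h1 : (m i * u) • v ∈ M := hJv _ (J.mul_mem_right _ (hM m hm))
    refine Submodule.mem_sup.mpr ⟨(m i * u) • v, ⟨_, J.mul_mem_right _ (hM m hm), rfl⟩,
      m - (m i * u) • v, ⟨sub_mem hm h1, ?_⟩, by abel⟩
    simp [mul_assoc, hu]
  · rw [eq_bot_iff]
    rintro _ ⟨⟨c, -, rfl⟩, -, h⟩
    have hc : c * v i = 0 := by simpa using h
    rw [hv.mul_left_eq_zero] at hc
    simp [hc]

end Helpers

section Local

variable {R : Type*} [CommRing R] [IsLocalRing R]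

theorem pow_notMem_of_isTwoDimRegularLocal (hreg : IsTwoDimRegularLocal R) {x y : R}
    (hxy : maximalIdeal R = Ideal.span {x, y}) (n : ℕ) :
    y ^ (n + 1) ∉ Ideal.span {x} * maximalIdeal R ^ n ⊔ maximalIdeal R ^ (n + 2) := by
  intro hy
  obtain ⟨hN, hd, -⟩ := hreg
  have h1 : maximalIdeal R ^ (n + 1) ≤
      Ideal.span {x} ⊔ maximalIdeal R • maximalIdeal R ^ (n + 1) := by
    have h2 : Ideal.span {x} * maximalIdeal R ^ n ⊔ maximalIdeal R ^ (n + 2) ≤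
        Ideal.span {x} ⊔ maximalIdeal R • maximalIdeal R ^ (n + 1) :=
      sup_le_sup Ideal.mul_le_left (by rw [smul_eq_mul, ← pow_succ'])
    have h3 := span_pair_pow_succ_le x y n
    rw [← hxy] at h3
    exact h3.trans (sup_le (le_sup_left.trans h2)
      ((Ideal.span_singleton_le_iff_mem _).mpr (h2 hy)))
  have h4 : maximalIdeal R ^ (n + 1) ≤ Ideal.span {x} :=
    Submodule.le_of_le_smul_of_le_jacobson_bot (IsNoetherian.noetherian _)
      (IsLocalRing.maximalIdeal_le_jacobson _) h1
  have hx : x ∈ maximalIdeal R := hxy ▸ Ideal.subset_span (by simp)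
  have hmin : maximalIdeal R ∈ (Ideal.span {x}).minimalPrimes := by
    refine ⟨⟨inferInstance, (Ideal.span_singleton_le_iff_mem _).mpr hx⟩, ?_⟩
    rintro p ⟨hp, hle⟩ -
    exact hp.le_of_pow_le (h4.trans hle)
  have h5 := Ideal.height_le_one_of_isPrincipal_of_mem_minimalPrimes _ _ hmin
  have h6 := IsLocalRing.maximalIdeal_height_eq_ringKrullDim (R := R)
  rw [hd] at h6
  have h7 : ((maximalIdeal R).height : WithBot ℕ∞) ≤ (1 : ℕ∞) := WithBot.coe_le_coe.mpr h5
  rw [h6] at h7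
  exact absurd h7 (by decide)

theorem exists_pair_sub_unit_mul_pow_mem [Infinite (ResidueField R)] {x y : R}
    (hxy : maximalIdeal R = Ideal.span {x, y}) {n : ℕ} {f : R}
    (hf : f ∈ maximalIdeal R ^ (n + 1)) (hf' : f ∉ maximalIdeal R ^ (n + 2)) :
    ∃ z c : R, maximalIdeal R = Ideal.span {z, y} ∧ IsUnit c ∧
      f - c * y ^ (n + 1) ∈ Ideal.span {z} * maximalIdeal R ^ n := by
  have hx : x ∈ maximalIdeal R := hxy ▸ Ideal.subset_span (by simp)
  have hy : y ∈ maximalIdeal R := hxy ▸ Ideal.subset_span (by simp)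
  have hmono : ∀ i k : ℕ, x ^ i * y ^ k ∈ maximalIdeal R ^ (i + k) := fun i k => by
    rw [pow_add]
    exact Ideal.mul_mem_mul (Ideal.pow_mem_pow hx _) (Ideal.pow_mem_pow hy _)
  obtain ⟨c, hc⟩ := exists_sum_of_mem_span_pair_pow x y (n + 1) (hxy ▸ hf)
  let q : Polynomial R := ∑ i ∈ Finset.range (n + 2), Polynomial.C (c i) * Polynomial.X ^ i
  have hq : q.map (residue R) ≠ 0 := by
    intro h0
    apply hf'
    rw [hc]
    refine sum_mem fun i hi => ?_
    have hci : c i ∈ maximalIdeal R := by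
      have := congrArg (fun p => Polynomial.coeff p i) h0
      simp only [q, Polynomial.coeff_map, Polynomial.finsetSum_coeff,
        Polynomial.coeff_C_mul_X_pow, Finset.sum_ite_eq, if_pos hi, Polynomial.coeff_zero] at this
      rwa [residue_eq_zero_iff] at this
    have h2 := Ideal.mul_mem_mul hci (hmono i (n + 1 - i))
    rw [Finset.mem_range] at hi
    rwa [← pow_succ', show i + (n + 1 - i) + 1 = n + 2 by omega] at h2
  obtain ⟨u', hu'⟩ : ∃ u', (q.map (residue R)).eval u' ≠ 0 := by
    by_contra! h
    exact hq (Polynomial.funext fun r => by simpa using h r)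
  obtain ⟨u, rfl⟩ := residue_surjective u'
  have hkey : ∀ i ≤ n + 1, x ^ i * y ^ (n + 1 - i) - u ^ i * y ^ (n + 1) ∈
      Ideal.span {x - u * y} * maximalIdeal R ^ n := by
    intro i
    induction i with
    | zero => simp
    | succ i ih =>
      intro hi
      have h1 := hmono i (n - i)
      rw [show i + (n - i) = n by omega] at h1
      have h2 := add_mem (Ideal.mul_mem_mul (Ideal.mem_span_singleton_self (x - u * y)) h1)
        (Ideal.mul_mem_left _ u (ih (by omega)))
      convert h2 using 1
      rw [show n + 1 - i = (n - i) + 1 by omega, show n + 1 - (i + 1) = n - i by omega]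
      ring
  refine ⟨x - u * y, q.eval u, ?_, ?_, ?_⟩
  · rw [hxy]
    apply le_antisymm <;> rw [Ideal.span_le, Set.insert_subset_iff, Set.singleton_subset_iff] <;>
      refine ⟨?_, Ideal.subset_span (by simp)⟩ <;> rw [SetLike.mem_coe, Ideal.mem_span_pair]
    · exact ⟨1, u, by ring⟩
    · exact ⟨1, -u, by ring⟩
  · rw [Polynomial.eval_map_apply] at hu'
    by_contra h
    exact hu' ((residue_eq_zero_iff _).mpr h)
  · have : f - q.eval u * y ^ (n + 1) = ∑ i ∈ Finset.range (n + 2),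
        c i * (x ^ i * y ^ (n + 1 - i) - u ^ i * y ^ (n + 1)) := by
      rw [hc, Polynomial.eval_finsetSum, Finset.sum_mul, ← Finset.sum_sub_distrib]
      refine Finset.sum_congr rfl fun i _ => ?_
      simp only [Polynomial.eval_mul, Polynomial.eval_C, Polynomial.eval_pow, Polynomial.eval_X]
      ring
    rw [this]
    exact sum_mem fun i hi => Ideal.mul_mem_left _ _
      (hkey i (by rw [Finset.mem_range] at hi; omega))

theorem apply_mem_maximalIdeal_of_not_hasFreeSummand {r : ℕ} {M : Submodule R (Fin r → R)}
    (hM : ¬ HasFreeSummand M) {m : Fin r → R} (hm : m ∈ M) (i : Fin r) :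
    m i ∈ maximalIdeal R := by
  by_contra h
  obtain ⟨N, P, hsup, hinf, ⟨e⟩⟩ := exists_sup_eq_inf_eq_bot_equiv M ⊤
    (notMem_maximalIdeal.mp h) (fun c _ => M.smul_mem c hm) fun _ _ => Submodule.mem_top
  have e' : N ≃ₗ[R] R := e.trans Submodule.topEquiv
  refine hM ⟨N, P, hsup, hinf, ?_, Module.Free.of_equiv e'.symm⟩
  rintro rfl
  exact not_subsingleton R e'.symm.toEquiv.subsingleton

theorem smul_mem_of_smul_mem_of_modIntClosed {n : ℕ} (hfg : (maximalIdeal R ^ n).FG)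
    {x y f c : R} (hxy : maximalIdeal R = Ideal.span {x, y}) (hc : IsUnit c)
    (hfc : f - c * y ^ (n + 1) ∈ Ideal.span {x} * maximalIdeal R ^ n)
    {M : Submodule R (Fin (n + 1) → R)} (hM : ModIntClosed M) (hf : f ∈ maxMinors M)
    (hmax : ∀ m ∈ M, ∀ i, m i ∈ maximalIdeal R) {v : Fin (n + 1) → R} (hv : x • v ∈ M) :
    y • v ∈ M := by
  have hy : y ∈ maximalIdeal R := hxy ▸ Ideal.subset_span (by simp)
  have hpow : maximalIdeal R ^ (n + 1) ≤
      Ideal.span {x} * maximalIdeal R ^ n ⊔ Ideal.span {f} := by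
    have h := span_pair_pow_succ_le x y n
    rw [← hxy] at h
    refine h.trans (sup_le le_sup_left ((Ideal.span_singleton_le_iff_mem _).mpr ?_))
    rw [← Ideal.unit_mul_mem_iff_mem _ hc]
    have := sub_mem (Ideal.mem_sup_right (Ideal.mem_span_singleton_self f))
      (Ideal.mem_sup_left (T := Ideal.span {f}) hfc)
    rwa [sub_sub_cancel] at this
  refine hM _ fun w j hwj hw => ?_
  have hdm := colDet_update_mem_pow w j v fun l hl => hmax _ (hw l hl)
  have hxd : x * colDet (Function.update w j v) ∈ maxMinors M := by
    rw [← colDet_update_smul]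
    refine Ideal.subset_span ⟨_, fun l => ?_, rfl⟩
    rcases eq_or_ne l j with rfl | hl
    · simpa using hv
    · simpa [Function.update_of_ne hl] using hw l hl
  have hw' : colDet w = y * colDet (Function.update w j v) := by
    rw [← colDet_update_smul, ← hwj, Function.update_eq_self]
  rw [hw']
  generalize colDet (Function.update w j v) = d at hdm hxd
  refine memIntClosure_of_mul_mem_mul hfg
    (Ideal.pow_mem_pow (Ideal.mul_mem_right d _ hy) n) fun k hk => ?_
  have hyk : y * k ∈ maximalIdeal R ^ (n + 1) := by
    rw [pow_succ']
    exact Ideal.mul_mem_mul hy hk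
  obtain ⟨_, ha, _, hb, hab⟩ := Submodule.mem_sup.mp (hpow hyk)
  obtain ⟨a, ha', rfl⟩ := Ideal.mem_span_singleton_mul.mp ha
  obtain ⟨b, rfl⟩ := Ideal.mem_span_singleton.mp hb
  have e : y * d * k = x * d * a + f * (d * b) := by linear_combination -d * hab
  rw [e]
  exact add_mem (Ideal.mul_mem_mul hxd ha') (Ideal.mul_mem_mul hf (Ideal.mul_mem_right _ _ hdm))

theorem exists_smul_single_add_smul_mem (hreg : IsTwoDimRegularLocal R) {n : ℕ} {x y f c : R}
    (hxy : maximalIdeal R = Ideal.span {x, y}) (hc : IsUnit c)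
    (hfc : f - c * y ^ (n + 1) ∈ Ideal.span {x} * maximalIdeal R ^ n)
    {M : Submodule R (Fin (n + 1) → R)} (hf : f ∈ maxMinors M)
    (hmax : ∀ m ∈ M, ∀ i, m i ∈ maximalIdeal R) :
    ∃ b : Fin (n + 1) → Fin (n + 1) → R, ∀ i, y • Pi.single i 1 + x • b i ∈ M := by
  have hy : y ∈ maximalIdeal R := hxy ▸ Ideal.subset_span (by simp)
  obtain ⟨w, hwM, hw⟩ : ∃ w : Fin (n + 1) → Fin (n + 1) → R, (∀ j, w j ∈ M) ∧
      colDet w ∉ Ideal.span {x} * maximalIdeal R ^ n ⊔ maximalIdeal R ^ (n + 2) := by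
    by_contra! h
    have hle : maxMinors M ≤
        Ideal.span {x} * maximalIdeal R ^ n ⊔ maximalIdeal R ^ (n + 2) := by
      refine Ideal.span_le.mpr ?_
      rintro _ ⟨w, hw, rfl⟩
      exact h w hw
    apply pow_notMem_of_isTwoDimRegularLocal hreg hxy n
    rw [← Ideal.unit_mul_mem_iff_mem _ hc]
    have := sub_mem (hle hf) (Ideal.mem_sup_left hfc)
    rwa [sub_sub_cancel] at this
  have hab : ∀ j i, ∃ a b, a * x + b * y = w j i := fun j i =>
    Ideal.mem_span_pair.mp (hxy ▸ hmax _ (hwM j) i)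
  choose b a hab using hab
  have hdet : IsUnit (Matrix.of a).det := by
    by_contra h
    have h1 := det_sub_det_mem (J := Ideal.span {x}) (K := maximalIdeal R)
      (Matrix.of w) (y • Matrix.of a) (fun i j => hmax _ (hwM i) j)
      (fun i j => Ideal.mul_mem_right _ _ hy) fun i j => by
        rw [Ideal.mem_span_singleton]
        exact ⟨b i j, by simp [← hab]; ring⟩
    have h2 : (y • Matrix.of a).det ∈ maximalIdeal R ^ (n + 2) := by
      rw [Matrix.det_smul, Fintype.card_fin, pow_succ (maximalIdeal R)]
      exact Ideal.mul_mem_mul (Ideal.pow_mem_pow hy _) h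
    apply hw
    rw [colDet_eq_det]
    have := add_mem (Ideal.mem_sup_left h1) (Ideal.mem_sup_right h2)
    rwa [sub_add_cancel] at this
  refine ⟨fun i l => ∑ j, (Matrix.of a)⁻¹ i j * b j l, fun i => ?_⟩
  have h : ∑ j, (Matrix.of a)⁻¹ i j • w j ∈ M := sum_mem fun j _ => M.smul_mem _ (hwM j)
  convert h using 1
  ext l
  have h1 := congrFun (congrFun (Matrix.nonsing_inv_mul _ hdet) i) l
  rw [Matrix.mul_apply] at h1
  simp only [Matrix.of_apply] at h1
  simp only [Pi.add_apply, Pi.smul_apply, smul_eq_mul, Finset.sum_apply, ← hab, mul_add,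
    Finset.sum_add_distrib, Finset.mul_sum]
  rw [show (Pi.single i 1 : Fin (n + 1) → R) l = (1 : Matrix _ _ R) i l by
    rw [Matrix.one_apply, Pi.single_apply]; simp only [eq_comm], ← h1, Finset.mul_sum, add_comm]
  congr 1 <;> exact Finset.sum_congr rfl fun j _ => by ring

theorem colDet_sub_mul_mem {n : ℕ} {x y : R} (hx : x ∈ maximalIdeal R)
    (hxy : maximalIdeal R = Ideal.span {x, y})
    {M : Submodule R (Fin (n + 1) → R)} (hmax : ∀ m ∈ M, ∀ i, m i ∈ maximalIdeal R)
    {b : Fin (n + 1) → Fin (n + 1) → R} (hb : ∀ i, y • Pi.single i 1 + x • b i ∈ M)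
    (hM : ∀ v, x • v ∈ M → ∀ i, v i ∈ maximalIdeal R)
    (w : Fin (n + 1) → Fin (n + 1) → R) (hw : ∀ j, w j ∈ M) :
    ∃ t, colDet w - t * colDet (fun i => y • Pi.single i 1 + x • b i) ∈
      maximalIdeal R ^ (n + 2) := by
  have hqp : ∀ j i, ∃ p q, p * x + q * y = w j i := fun j i =>
    Ideal.mem_span_pair.mp (hxy ▸ hmax _ (hw j) i)
  choose p q hpq using hqp
  refine ⟨(Matrix.of q).det, ?_⟩
  rw [colDet_eq_det, colDet_eq_det, ← Matrix.det_mul, pow_add, mul_comm]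
  obtain ⟨B, hB⟩ : ∃ B : Matrix (Fin (n + 1)) (Fin (n + 1)) R,
      B = Matrix.of fun i => y • Pi.single i 1 + x • b i := ⟨_, rfl⟩
  rw [← hB]
  have hrow : ∀ j, (Matrix.of q * B) j =
      ∑ l, q j l • (y • Pi.single l 1 + x • b l) := fun j => by
    ext i
    simp [hB, Matrix.mul_apply, mul_add]
  have hrowM : ∀ j, (Matrix.of q * B) j ∈ M :=
    fun j => by
      rw [hrow]
      exact sum_mem fun l _ => M.smul_mem _ (hb l)
  refine det_sub_det_mem _ _ (fun j i => hmax _ (hw j) i) (fun j i => hmax _ (hrowM j) i)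
    fun j i => ?_
  have hdiff : w j - (Matrix.of q * B) j =
      x • (p j - ∑ l, q j l • b l) := by
    rw [hrow]
    ext i
    simp only [Pi.sub_apply, Finset.sum_apply, Pi.smul_apply, Pi.add_apply, smul_eq_mul, ← hpq,
      mul_add, Finset.sum_add_distrib, Pi.single_apply, mul_ite, mul_one, mul_zero,
      Finset.sum_ite_eq, Finset.mem_univ, if_true, mul_sub, Finset.mul_sum]
    rw [Finset.sum_congr rfl fun l _ => mul_left_comm (q j l) x (b l i)]
    ring
  have hmem := hM _ (hdiff ▸ sub_mem (hw j) (hrowM j)) i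
  have := Ideal.mul_mem_mul hx hmem
  rw [← pow_two] at this
  have e : w j i - (Matrix.of q * B) j i = _ := congrFun hdiff i
  rw [Matrix.of_apply, e]
  exact this

theorem exists_smul_mem_apply_notMem (hreg : IsTwoDimRegularLocal R) {n : ℕ} {x y f c : R}
    (hxy : maximalIdeal R = Ideal.span {x, y}) (hc : IsUnit c)
    (hfc : f - c * y ^ (n + 1) ∈ Ideal.span {x} * maximalIdeal R ^ n)
    {M : Submodule R (Fin (n + 1) → R)} (hf : f ∈ maxMinors M)
    (hmax : ∀ m ∈ M, ∀ i, m i ∈ maximalIdeal R)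
    (hdim : ∃ f ∈ maxMinors M, ∃ g ∈ maxMinors M, ∀ c d : R,
      c * f + d * g ∈ maximalIdeal R ^ (n + 2) → c ∈ maximalIdeal R ∧ d ∈ maximalIdeal R) :
    ∃ v : Fin (n + 1) → R, x • v ∈ M ∧ ∃ i, v i ∉ maximalIdeal R := by
  have hx : x ∈ maximalIdeal R := hxy ▸ Ideal.subset_span (by simp)
  have hy : y ∈ maximalIdeal R := hxy ▸ Ideal.subset_span (by simp)
  by_contra! hM
  obtain ⟨b, hb⟩ := exists_smul_single_add_smul_mem hreg hxy hc hfc hf hmax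
  obtain ⟨w₀, hw₀⟩ : ∃ w₀ : Fin (n + 1) → Fin (n + 1) → R,
      w₀ = fun i => y • Pi.single i 1 + x • b i := ⟨_, rfl⟩
  have hw₀M : ∀ i, w₀ i ∈ M := fun i => hw₀ ▸ hb i
  have hδ : colDet w₀ ∈ maximalIdeal R ^ (n + 1) := by
    have := det_sub_det_mem (J := maximalIdeal R) (K := maximalIdeal R)
      (Matrix.of w₀) 0 (fun i j => hmax _ (hw₀M i) j)
      (fun _ _ => zero_mem _) fun i j => by
        rw [Matrix.zero_apply, sub_zero]
        exact hmax _ (hw₀M i) j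
    rwa [Matrix.det_zero, sub_zero, ← pow_succ', ← colDet_eq_det] at this
  have hcol := colDet_sub_mul_mem hx hxy hmax hb hM
  rw [← hw₀] at hcol
  generalize colDet w₀ = δ at hδ hcol
  have hle : maxMinors M ≤ Ideal.span {δ} ⊔ maximalIdeal R ^ (n + 2) := by
    refine Ideal.span_le.mpr ?_
    rintro _ ⟨w, hw, rfl⟩
    obtain ⟨t, ht⟩ := hcol w hw
    have := add_mem (Ideal.mem_sup_right ht)
      (Ideal.mem_sup_left (Ideal.mul_mem_left _ t (Ideal.mem_span_singleton_self δ)))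
    rwa [sub_add_cancel] at this
  obtain ⟨f, hf, g, hg, hfg⟩ := hdim
  obtain ⟨_, hs, f', hf', rfl⟩ := Submodule.mem_sup.mp (hle hf)
  obtain ⟨_, ht, g', hg', rfl⟩ := Submodule.mem_sup.mp (hle hg)
  obtain ⟨s, rfl⟩ := Ideal.mem_span_singleton.mp hs
  obtain ⟨t, rfl⟩ := Ideal.mem_span_singleton.mp ht
  have hst := hfg t (-s) (by
    rw [show t * (δ * s + f') + -s * (δ * t + g') = t * f' - s * g' by ring]
    exact sub_mem (Ideal.mul_mem_left _ _ hf') (Ideal.mul_mem_left _ _ hg'))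
  have hs' : s ∈ maximalIdeal R := neg_mem_iff.mp hst.2
  have h1 := (hfg 1 0 (by
    rw [one_mul, zero_mul, add_zero]
    refine add_mem ?_ hf'
    rw [pow_succ]
    exact Ideal.mul_mem_mul hδ hs')).1
  exact (Ideal.ne_top_iff_one _).mp (maximalIdeal.isMaximal R).ne_top h1

end Local

/-- if `I` is an integrally closed `𝔪`-primary ideal of order `r` whose image
in `𝔪^r/𝔪^(r+1)` is at least 2-dimensional over the residue field, and `I = I(M)` for an
integrally closed module `M` of rank `r` without free direct summands, then `𝔪` is a
direct summand of `M`. -/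
theorem statement16 (R : Type*) [CommRing R] [IsLocalRing R]
    (hreg : IsTwoDimRegularLocal R) [Infinite (IsLocalRing.ResidueField R)]
    (r : ℕ) (I : Ideal R) (hIc : IdealIntClosed I) (hIp : IsMPrimary I)
    (hord : ordEQ I r)
    (hdim : ∃ f ∈ I, ∃ g ∈ I, ∀ c d : R,
      c * f + d * g ∈ maximalIdeal R ^ (r + 1) →
        c ∈ maximalIdeal R ∧ d ∈ maximalIdeal R)
    (M : Submodule R (Fin r → R)) (h1 : FinColength M) (h2 : ModIntClosed M)
    (h3 : ¬ HasFreeSummand M) (h4 : maxMinors M = I) :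
    ∃ N P : Submodule R (Fin r → R), N ⊔ P = M ∧ N ⊓ P = ⊥ ∧
      Nonempty (↥N ≃ₗ[R] ↥(maximalIdeal R)) := by
  subst h4
  have hmax : ∀ m ∈ M, ∀ i, m i ∈ maximalIdeal R := fun m hm i =>
    apply_mem_maximalIdeal_of_not_hasFreeSummand h3 hm i
  obtain ⟨hN, -, x₀, y, hxy₀⟩ := id hreg
  obtain _ | n := r
  · have htop : maxMinors M = ⊤ :=
      (Ideal.eq_top_iff_one _).mpr
        (Ideal.subset_span ⟨0, fun j => j.elim0, by simp [colDet]⟩)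
    rw [IsMPrimary, htop, Ideal.radical_top] at hIp
    exact absurd hIp.symm (maximalIdeal.isMaximal R).ne_top
  obtain ⟨f, hf, hf'⟩ := SetLike.not_le_iff_exists.mp hord.2
  obtain ⟨x, c, hxy, hc, hfc⟩ := exists_pair_sub_unit_mul_pow_mem hxy₀ (hord.1 hf) hf'
  obtain ⟨v, hxv, i, hvi⟩ := exists_smul_mem_apply_notMem hreg hxy hc hfc hf hmax hdim
  have hyv := smul_mem_of_smul_mem_of_modIntClosed (IsNoetherian.noetherian _) hxy hc hfc h2 hf
    hmax hxv
  refine exists_sup_eq_inf_eq_bot_equiv M _ (notMem_maximalIdeal.mp hvi) (fun k hk => ?_)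
    fun m hm => hmax m hm i
  rw [hxy] at hk
  obtain ⟨a, b, rfl⟩ := Ideal.mem_span_pair.mp hk
  rw [add_smul, mul_smul, mul_smul]
  exact add_mem (M.smul_mem a hxv) (M.smul_mem b hyv)
end

section
/- Let (R, 𝔪) be a two-dimensional regular local ring with infinite residue field and let K be an integrally closed 𝔪-primary ideal of order r−1. If I = 𝔪K is the ideal of maximal minors I(M) of an integrally closed finitely generated torsion-free R-module M of rank r without free direct summands, then 𝔪 is a direct summand of M. -/
open IsLocalRing

open Polynomial in
/-- If a nonzero finitely generated ideal `J` of a domain satisfies `zJ ⊆ IJ`, then `z` lies in the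
integral closure of `I`. -/
theorem memIntClosure_of_mul_mem {R : Type*} [CommRing R] [IsDomain R] {I J : Ideal R} {z : R}
    (hJ : J ≠ ⊥) (hfg : J.FG) (h : ∀ a ∈ J, z * a ∈ I * J) : MemIntClosure I z := by
  have : Module.Finite R J := Module.Finite.iff_fg.mpr hfg
  obtain ⟨b, hb, hb0⟩ := Submodule.exists_mem_ne_zero_of_ne_bot hJ
  obtain ⟨p, hp, -, hc, ha⟩ :=
    LinearMap.exists_monic_and_natDegree_eq_and_coeff_mem_pow_and_aeval_eq_zero R
      (algebraMap R (Module.End R J) z) I (by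
        rintro _ ⟨a, rfl⟩
        have h1 : ((z • a : J) : R) ∈ Submodule.map J.subtype (I • (⊤ : Submodule R J)) := by
          rw [Submodule.map_smul'', Submodule.map_top, Submodule.range_subtype]
          exact h a a.2
        obtain ⟨c, hc, hca⟩ := h1
        have hcz : c = z • a := Subtype.ext hca
        rw [hcz] at hc
        exact hc)
  have hz : p.eval z = 0 := by
    rw [Polynomial.aeval_algebraMap_apply] at ha
    have h2 := congrArg (fun f : Module.End R J => ((f ⟨b, hb⟩ : J) : R)) ha
    simpa [hb0, Module.algebraMap_end_apply] using h2
  refine ⟨p.natDegree, ?_, fun i => p.coeff (p.natDegree - i), fun i hi => ?_, ?_⟩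
  · rw [pos_iff_ne_zero, Ne, hp.natDegree_eq_zero]
    rintro rfl
    simp at hz
  · have := hc (p.natDegree - i)
    rwa [Nat.sub_sub_self (Finset.mem_Icc.mp hi).2] at this
  · rw [Polynomial.eval_eq_sum_range, Finset.sum_range_succ, hp.coeff_natDegree, one_mul,
      add_comm] at hz
    rw [← hz, ← Finset.sum_range_reflect]
    congr 1
    refine Finset.sum_bij' (fun i _ => i - 1) (fun i _ => i + 1) ?_ ?_ ?_ ?_ ?_
    · intro i hi
      simp only [Finset.mem_Icc, Finset.mem_range] at *
      omega
    · intro i hi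
      simp only [Finset.mem_Icc, Finset.mem_range] at *
      omega
    · intro i hi
      simp only [Finset.mem_Icc] at hi
      omega
    · intro i _
      simp
    · intro i hi
      simp only [Finset.mem_Icc] at hi
      rw [show p.natDegree - 1 - (i - 1) = p.natDegree - i by omega]

section RegularParameters

variable {R : Type*} [CommRing R] [IsLocalRing R] {x y : R}

theorem maximalIdeal_pow_succ_le (hxy : maximalIdeal R = Ideal.span {x, y}) (n : ℕ) :
    maximalIdeal R ^ (n + 1) ≤
      Ideal.span {x} * maximalIdeal R ^ n ⊔ Ideal.span {y ^ (n + 1)} := by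
  induction n with
  | zero => simp [hxy, Ideal.span_insert]
  | succ n ih =>
    have hm : maximalIdeal R = Ideal.span {x} ⊔ Ideal.span {y} := by rw [hxy, Ideal.span_insert]
    calc maximalIdeal R ^ (n + 1 + 1)
        = (Ideal.span {x} ⊔ Ideal.span {y}) * maximalIdeal R ^ (n + 1) := by
          rw [← hm, pow_succ']
      _ ≤ Ideal.span {x} * maximalIdeal R ^ (n + 1) ⊔
          Ideal.span {y} * (Ideal.span {x} * maximalIdeal R ^ n ⊔ Ideal.span {y ^ (n + 1)}) := by
          rw [Ideal.sup_mul]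
          exact sup_le_sup_left (Ideal.mul_mono_right ih) _
      _ ≤ _ := by
          rw [Ideal.mul_sup, Ideal.span_singleton_mul_span_singleton, ← pow_succ', ← sup_assoc]
          refine sup_le_sup_right (sup_le le_rfl ?_) _
          rw [mul_left_comm, pow_succ' (maximalIdeal R)]
          refine Ideal.mul_mono_right (Ideal.mul_mono_left ?_)
          rw [hm]
          exact le_sup_right

theorem ne_maximalIdeal_of_mem_minimalPrimes [IsNoetherianRing R] (hdim : ringKrullDim R = 2)
    {p : Ideal R} (hp : p ∈ (Ideal.span {x}).minimalPrimes) : p ≠ maximalIdeal R := by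
  rintro rfl
  have h1 := Ideal.height_le_one_of_isPrincipal_of_mem_minimalPrimes _ _ hp
  have h2 := IsLocalRing.maximalIdeal_height_eq_ringKrullDim (R := R)
  rw [hdim] at h2
  have h3 : (maximalIdeal R).height = 2 := WithBot.coe_injective h2
  rw [h3] at h1
  exact absurd h1 (by decide)

theorem eq_maximalIdeal_of_mem (hxy : maximalIdeal R = Ideal.span {x, y}) {p : Ideal R}
    [hp : p.IsPrime] (hx : x ∈ p) (hy : y ∈ p) : p = maximalIdeal R := by
  refine le_antisymm (le_maximalIdeal hp.ne_top) ?_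
  rw [hxy, Ideal.span_le]
  rintro _ (rfl | rfl) <;> assumption

theorem span_singleton_mem_minimalPrimes [IsNoetherianRing R] (hdim : ringKrullDim R = 2)
    (hxy : maximalIdeal R = Ideal.span {x, y}) :
    Ideal.span {x} ∈ (Ideal.span {x}).minimalPrimes := by
  have hx : x ∈ maximalIdeal R := hxy ▸ Ideal.subset_span (by simp)
  have hy : y ∈ maximalIdeal R := hxy ▸ Ideal.subset_span (by simp)
  have hle : Ideal.span {x} ≤ maximalIdeal R := by simpa [Ideal.span_le] using hx
  obtain ⟨p, hp, -⟩ := Ideal.exists_minimalPrimes_le hle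
  have hpp : p.IsPrime := hp.1.1
  have hxp : x ∈ p := hp.1.2 (Ideal.mem_span_singleton_self x)
  have hyp : y ∉ p := fun hyp =>
    ne_maximalIdeal_of_mem_minimalPrimes hdim hp (eq_maximalIdeal_of_mem hxy hxp hyp)
  have key : p ≤ Ideal.span {x} := by
    refine Submodule.le_of_le_smul_of_le_jacobson_bot (I := maximalIdeal R)
      (IsNoetherian.noetherian p) (jacobson_eq_maximalIdeal ⊥ bot_ne_top).ge ?_
    intro b hb
    have hb' := le_maximalIdeal hpp.ne_top hb
    rw [hxy, Ideal.mem_span_pair] at hb'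
    obtain ⟨α, β, rfl⟩ := hb'
    refine Submodule.add_mem_sup (Ideal.mul_mem_left _ _ (Ideal.mem_span_singleton_self x)) ?_
    have h1 : β * y ∈ p := (Ideal.add_mem_iff_right _ (Ideal.mul_mem_left _ _ hxp)).mp hb
    have h2 : β ∈ p := (hpp.mem_or_mem h1).resolve_right hyp
    rw [mul_comm, smul_eq_mul]
    exact Ideal.mul_mem_mul hy h2
  rwa [le_antisymm key hp.1.2] at hp

theorem isPrime_span_singleton [IsNoetherianRing R] (hdim : ringKrullDim R = 2)
    (hxy : maximalIdeal R = Ideal.span {x, y}) : (Ideal.span {x}).IsPrime :=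
  (span_singleton_mem_minimalPrimes hdim hxy).1.1

theorem notMem_span_singleton [IsNoetherianRing R] (hdim : ringKrullDim R = 2)
    (hxy : maximalIdeal R = Ideal.span {x, y}) : y ∉ Ideal.span {x} := fun hy =>
  have := isPrime_span_singleton hdim hxy
  ne_maximalIdeal_of_mem_minimalPrimes hdim (span_singleton_mem_minimalPrimes hdim hxy)
    (eq_maximalIdeal_of_mem hxy (Ideal.mem_span_singleton_self x) hy)

theorem maximalIdeal_eq_span_sub_mul (hxy : maximalIdeal R = Ideal.span {x, y}) (t : R) :
    maximalIdeal R = Ideal.span {x - t * y, y} := by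
  rw [hxy]
  refine le_antisymm ?_ ?_ <;> rw [Ideal.span_le] <;> rintro _ (rfl | rfl) <;>
    rw [SetLike.mem_coe, Ideal.mem_span_pair]
  exacts [⟨1, t, by ring⟩, ⟨0, 1, by ring⟩, ⟨1, -t, by ring⟩, ⟨0, 1, by ring⟩]

theorem isDomain_of_isTwoDimRegularLocal [Infinite (ResidueField R)]
    (hreg : IsTwoDimRegularLocal R) : IsDomain R := by
  obtain ⟨_, hdim, x, y, hxy⟩ := hreg
  obtain ⟨t, ht⟩ : ∃ t : R, ∀ p ∈ minimalPrimes R, x - t * y ∉ p := by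
    by_contra! hcon
    obtain ⟨σ, hσ⟩ := Ideal.Quotient.mk_surjective (I := maximalIdeal R) |>.hasRightInverse
    choose p hp hmem using hcon
    have : Finite (minimalPrimes R) := minimalPrimes.finite_of_isNoetherianRing R
    refine not_injective_infinite_finite
      (fun a : ResidueField R => (⟨p (σ a), hp _⟩ : minimalPrimes R)) fun a b hab => ?_
    have hab' : p (σ a) = p (σ b) := congrArg Subtype.val hab
    have hpp : (p (σ a)).IsPrime := (hp (σ a)).1.1
    have h1 : (σ a - σ b) * y ∈ p (σ a) := by
      have := (p (σ a)).sub_mem (hab' ▸ hmem (σ b)) (hmem (σ a))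
      convert this using 1
      ring
    rcases hpp.mem_or_mem h1 with h | h
    · have h2 := Ideal.Quotient.eq.mpr (le_maximalIdeal hpp.ne_top h)
      exact (hσ a).symm.trans (h2.trans (hσ b))
    · exfalso
      have h2 := eq_maximalIdeal_of_mem (maximalIdeal_eq_span_sub_mul hxy (σ a)) (hmem _) h
      have h3 : p (σ a) ∈ (Ideal.span {(0 : R)}).minimalPrimes := by
        simpa [minimalPrimes] using hp (σ a)
      exact ne_maximalIdeal_of_mem_minimalPrimes hdim h3 h2
  have hxy' := maximalIdeal_eq_span_sub_mul hxy t
  have hprime := isPrime_span_singleton hdim hxy'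
  obtain ⟨p, hp, hple⟩ := Ideal.exists_minimalPrimes_le
    (bot_le : (⊥ : Ideal R) ≤ Ideal.span {x - t * y})
  have hpp : p.IsPrime := hp.1.1
  have hp0 : p = ⊥ := by
    refine Submodule.eq_bot_of_le_smul_of_le_jacobson_bot (maximalIdeal R) p
      (IsNoetherian.noetherian p) (fun b hb => ?_) (jacobson_eq_maximalIdeal ⊥ bot_ne_top).ge
    obtain ⟨c, rfl⟩ := Ideal.mem_span_singleton.mp (hple hb)
    have hc : c ∈ p := (hpp.mem_or_mem hb).resolve_left (ht p hp)
    exact Ideal.mul_mem_mul (hxy' ▸ Ideal.subset_span (by simp)) hc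
  exact IsDomain.of_bot_isPrime R (hbp := hp0 ▸ hpp)

theorem mem_maximalIdeal_pow_of_mul_mem [IsNoetherianRing R] [IsDomain R]
    (hdim : ringKrullDim R = 2) (hxy : maximalIdeal R = Ideal.span {x, y}) {n : ℕ} {f : R}
    (hf : x * f ∈ maximalIdeal R ^ (n + 1)) : f ∈ maximalIdeal R ^ n := by
  have hx0 : x ≠ 0 := by
    rintro rfl
    have h1 : maximalIdeal R = Ideal.span {y, 0} := by rw [hxy, Set.pair_comm]
    have h2 := isPrime_span_singleton hdim h1
    refine ne_maximalIdeal_of_mem_minimalPrimes hdim (span_singleton_mem_minimalPrimes hdim h1) ?_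
    rw [h1]
    simp
  have hprime := isPrime_span_singleton hdim hxy
  obtain ⟨b, hb, c, hc, hbc⟩ := Submodule.mem_sup.mp (maximalIdeal_pow_succ_le hxy n hf)
  obtain ⟨g, hg, rfl⟩ := Ideal.mem_span_singleton_mul.mp hb
  obtain ⟨s, rfl⟩ := Ideal.mem_span_singleton.mp hc
  have h1 : y ^ (n + 1) * s ∈ Ideal.span {x} :=
    Ideal.mem_span_singleton.mpr ⟨f - g, by rw [mul_sub, ← hbc]; ring⟩
  obtain ⟨t, rfl⟩ : x ∣ s := by
    rcases hprime.mem_or_mem h1 with h | h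
    · exact absurd (hprime.mem_of_pow_mem _ h) (notMem_span_singleton hdim hxy)
    · exact Ideal.mem_span_singleton.mp h
  have h2 : f = g + y ^ (n + 1) * t := mul_left_cancel₀ hx0 (by rw [← hbc]; ring)
  rw [h2]
  have hy : y ∈ maximalIdeal R := hxy ▸ Ideal.subset_span (by simp)
  exact add_mem hg (Ideal.mul_mem_right _ _
    (Ideal.pow_le_pow_right n.le_succ (Ideal.pow_mem_pow hy _)))

/-- Over a two-dimensional regular local ring, if `𝔪f ⊆ (a) + 𝔪 ^ (n + 1)` for some `a ∈ 𝔪 ^ n`,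
then `f ∈ 𝔪 ^ n`. -/
theorem mem_maximalIdeal_pow_of_mul_mem_span_sup [IsNoetherianRing R] [IsDomain R]
    (hdim : ringKrullDim R = 2) (hxy : maximalIdeal R = Ideal.span {x, y}) {n : ℕ} {a f : R}
    (ha : a ∈ maximalIdeal R ^ n)
    (hf : ∀ z ∈ maximalIdeal R, z * f ∈ Ideal.span {a} ⊔ maximalIdeal R ^ (n + 1)) :
    f ∈ maximalIdeal R ^ n := by
  have hx : x ∈ maximalIdeal R := hxy ▸ Ideal.subset_span (by simp)
  have hy : y ∈ maximalIdeal R := hxy ▸ Ideal.subset_span (by simp)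
  obtain ⟨α, c, hc, hαc⟩ := Ideal.mem_span_singleton_sup.mp (hf x hx)
  obtain ⟨β, d, hd, hβd⟩ := Ideal.mem_span_singleton_sup.mp (hf y hy)
  by_cases hα : α ∈ maximalIdeal R
  · refine mem_maximalIdeal_pow_of_mul_mem hdim hxy ?_
    rw [← hαc]
    refine add_mem ?_ hc
    rw [pow_succ']
    exact Ideal.mul_mem_mul hα ha
  · obtain ⟨γ, hγ⟩ := (notMem_maximalIdeal.mp hα).exists_right_inv
    have hyx : maximalIdeal R = Ideal.span {y, x} := by rw [hxy, Set.pair_comm]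
    refine mem_maximalIdeal_pow_of_mul_mem hdim (maximalIdeal_eq_span_sub_mul hyx (β * γ)) ?_
    have h1 : (y - β * γ * x) * f = d - β * γ * c := by
      linear_combination (-1 : R) * hβd + β * γ * hαc - β * a * hγ
    rw [h1]
    exact sub_mem hd (Ideal.mul_mem_left _ _ hc)

end RegularParameters

section Columns

variable {R : Type*} [CommRing R] {r : ℕ}

theorem colDet_eq_detRowAlternating (w : Fin r → Fin r → R) :
    colDet w = Matrix.detRowAlternating w :=
  Matrix.det_transpose (Matrix.of w)

theorem colDet_mem_pow_sum {I : Ideal R} {w : Fin r → Fin r → R} {n : Fin r → ℕ}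
    (hw : ∀ j i, w j i ∈ I ^ n j) : colDet w ∈ I ^ ∑ j, n j := by
  rw [colDet, Matrix.det_apply]
  refine sum_mem fun σ _ => Submodule.smul_of_tower_mem _ _ ?_
  rw [← Finset.prod_pow_eq_pow_sum]
  exact Ideal.prod_mem_prod fun j _ => hw j _

theorem colDet_add_eq_sum (v w : Fin r → Fin r → R) :
    colDet (v + w) = ∑ s : Finset (Fin r), colDet (s.piecewise v w) := by
  simp only [colDet_eq_detRowAlternating]
  exact Matrix.detRowAlternating.toMultilinearMap.map_add_univ v w

theorem colDet_smul_add_smul (x y : R) (v w : Fin r → Fin r → R) :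
    colDet (x • v + y • w) =
      ∑ k ∈ Finset.range (r + 1),
        (∑ s ∈ Finset.univ.filter fun s : Finset (Fin r) => s.card = k,
          colDet (s.piecewise v w)) * (x ^ k * y ^ (r - k)) := by
  rw [colDet_add_eq_sum]
  have hterm : ∀ s : Finset (Fin r), colDet (s.piecewise (x • v) (y • w)) =
      colDet (s.piecewise v w) * (x ^ s.card * y ^ (r - s.card)) := by
    intro s
    have h1 : s.piecewise (x • v) (y • w) =
        fun j => (if j ∈ s then x else y) • s.piecewise v w j := by
      funext j
      by_cases hj : j ∈ s <;> simp [hj]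
    rw [h1, colDet_eq_detRowAlternating, colDet_eq_detRowAlternating]
    have h2 := Matrix.detRowAlternating.toMultilinearMap.map_smul_univ
      (fun j => if j ∈ s then x else y) (s.piecewise v w)
    have h3 : ∏ j, (if j ∈ s then x else y) = x ^ s.card * y ^ (r - s.card) := by
      rw [Finset.prod_ite, Finset.prod_const, Finset.prod_const]
      congr 2
      · simp
      · rw [Finset.filter_not, Finset.card_sdiff]
        simp
    rw [h3, smul_eq_mul, mul_comm] at h2
    exact h2
  simp only [hterm, Finset.sum_mul]
  rw [← Finset.sum_fiberwise_of_maps_to (s := Finset.univ) (t := Finset.range (r + 1))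
    (g := fun s : Finset (Fin r) => s.card)]
  · refine Finset.sum_congr rfl fun k _ => Finset.sum_congr rfl fun s hs => ?_
    rw [(Finset.mem_filter.mp hs).2]
  · intro s _
    have := s.card_le_univ
    rw [Fintype.card_fin] at this
    exact Finset.mem_range.mpr (Nat.lt_succ_of_le this)

/-- If `xA + yB` has determinant outside `𝔪 ^ (r + 1)`, where `x, y ∈ 𝔪`, then `tA + B` is
invertible for some `t`. -/
theorem exists_isUnit_colDet [IsLocalRing R] [Infinite (ResidueField R)] {x y : R}
    (hx : x ∈ maximalIdeal R) (hy : y ∈ maximalIdeal R) {v w : Fin r → Fin r → R}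
    (h : colDet (x • v + y • w) ∉ maximalIdeal R ^ (r + 1)) :
    ∃ t : R, IsUnit (colDet (t • v + w)) := by
  set c : ℕ → R := fun k => ∑ s ∈ Finset.univ.filter fun s : Finset (Fin r) => s.card = k,
    colDet (s.piecewise v w)
  obtain ⟨k, hk, hck⟩ : ∃ k ∈ Finset.range (r + 1), c k ∉ maximalIdeal R := by
    by_contra! hcon
    refine h ?_
    rw [colDet_smul_add_smul]
    refine sum_mem fun k hk => ?_
    rw [pow_succ']
    refine Ideal.mul_mem_mul (hcon k hk) ?_
    have h1 := Ideal.mul_mem_mul (Ideal.pow_mem_pow hx k) (Ideal.pow_mem_pow hy (r - k))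
    rwa [← pow_add, Nat.add_sub_cancel' (Nat.lt_succ_iff.mp (Finset.mem_range.mp hk))] at h1
  let p : Polynomial (ResidueField R) :=
    ∑ k ∈ Finset.range (r + 1), Polynomial.monomial k (residue R (c k))
  have hp : p ≠ 0 := by
    intro hp0
    have h1 : p.coeff k = residue R (c k) := by
      simp only [p, Polynomial.finsetSum_coeff, Polynomial.coeff_monomial]
      rw [Finset.sum_ite_eq' _ k, if_pos hk]
    rw [hp0, Polynomial.coeff_zero] at h1
    exact hck ((residue_eq_zero_iff _).mp h1.symm)
  obtain ⟨τ, hτ⟩ : ∃ τ, p.eval τ ≠ 0 := by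
    by_contra! hcon
    exact hp (Polynomial.funext (by simpa using hcon))
  obtain ⟨t, rfl⟩ := residue_surjective τ
  refine ⟨t, ?_⟩
  rw [← residue_ne_zero_iff_isUnit]
  convert hτ using 1
  have h1 := colDet_smul_add_smul t 1 v w
  rw [one_smul] at h1
  rw [h1, map_sum, Polynomial.eval_finsetSum]
  refine Finset.sum_congr rfl fun k _ => ?_
  rw [Polynomial.eval_monomial]
  simp [c]

/-- Determinants of columns `g u + v`, where `u` has entries in `I`, `v` has entries in `I ^ 2` and
`g` maps into `I F`, are multiples of `det g` modulo `I ^ (r + 1)`. -/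
theorem colDet_mem_span_det_sup {I : Ideal R} (g : (Fin r → R) →ₗ[R] (Fin r → R))
    (hg : ∀ u i, g u i ∈ I) {u v : Fin r → Fin r → R} (hv : ∀ j i, v j i ∈ I ^ 2) :
    colDet (fun j => g (u j) + v j) ∈ Ideal.span {LinearMap.det g} ⊔ I ^ (r + 1) := by
  have h0 : (fun j => g (u j) + v j) = (fun j => g (u j)) + v := rfl
  rw [h0, colDet_add_eq_sum]
  refine sum_mem fun s _ => ?_
  by_cases hs : s = Finset.univ
  · refine Submodule.mem_sup_left (Ideal.mem_span_singleton.mpr ?_)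
    refine ⟨colDet u, ?_⟩
    rw [hs, Finset.piecewise_univ]
    have h1 := LinearMap.det_comp g (Matrix.toLin' (Matrix.of fun i j => u j i))
    rw [LinearMap.det_toLin', ← LinearMap.det_toMatrix' (f := g ∘ₗ _)] at h1
    rw [colDet, colDet, ← h1]
    congr 1
    ext i j
    simp [LinearMap.toMatrix'_apply, Matrix.col_def]
    rfl
  · refine Submodule.mem_sup_right ?_
    obtain ⟨k, hk⟩ : ∃ k, k ∉ s := by
      by_contra! hcon
      exact hs (Finset.eq_univ_iff_forall.mpr hcon)
    have h1 := colDet_mem_pow_sum (I := I) (w := s.piecewise (fun j => g (u j)) v)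
      (n := fun j => if j ∈ s then 1 else 2) (by
        intro j i
        by_cases hj : j ∈ s
        · simpa [hj] using hg _ _
        · simpa [hj] using hv _ _)
    refine Ideal.pow_le_pow_right ?_ h1
    have h2 : ∑ j : Fin r, 1 < ∑ j, if j ∈ s then 1 else 2 :=
      Finset.sum_lt_sum (fun j _ => by split_ifs <;> simp) ⟨k, Finset.mem_univ _, by simp [hk]⟩
    simpa using h2

end Columns

section Submodules

variable {R : Type*} [CommRing R] {r : ℕ} {M : Submodule R (Fin r → R)}

theorem ne_zero_of_maxMinors_ne_top (h : maxMinors M ≠ ⊤) : r ≠ 0 := by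
  rintro rfl
  exact h ((Ideal.eq_top_iff_one _).mpr
    (Ideal.subset_span ⟨0, fun j => j.elim0, by simp [colDet]⟩))

theorem mem_maximalIdeal_of_not_hasFreeSummand [IsLocalRing R] (h : ¬ HasFreeSummand M)
    {v : Fin r → R} (hv : v ∈ M) (i : Fin r) : v i ∈ maximalIdeal R := by
  by_contra hvi
  obtain ⟨c, hc⟩ := (notMem_maximalIdeal.mp hvi).exists_right_inv
  have hv0 : v ≠ 0 := by
    rintro rfl
    simp at hc
  have hinj : ∀ a : R, a • v = 0 → a = 0 := fun a ha => by
    have h1 : a * v i = 0 := congrFun ha i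
    linear_combination c * h1 - a * hc
  refine h ⟨R ∙ v, M ⊓ LinearMap.ker (LinearMap.proj (R := R) (φ := fun _ => R) i),
    ?_, ?_, by simpa using hv0, ?_⟩
  · refine le_antisymm (sup_le (by simpa using hv) inf_le_left) fun w hw => ?_
    rw [← add_sub_cancel ((w i * c) • v) w]
    refine Submodule.add_mem_sup (Submodule.smul_mem _ _ (Submodule.mem_span_singleton_self v))
      ⟨M.sub_mem hw (M.smul_mem _ hv), ?_⟩
    rw [SetLike.mem_coe, LinearMap.mem_ker, LinearMap.proj_apply, Pi.sub_apply, Pi.smul_apply,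
      smul_eq_mul]
    linear_combination -(w i) * hc
  · rw [eq_bot_iff]
    rintro w ⟨hw, -, hw'⟩
    obtain ⟨a, rfl⟩ := Submodule.mem_span_singleton.mp hw
    have h1 : a * v i = 0 := hw'
    have h2 : a = 0 := by linear_combination c * h1 - a * hc
    simp [h2]
  · let e : R →ₗ[R] (R ∙ v) := LinearMap.toSpanSingleton R _
      ⟨v, Submodule.mem_span_singleton_self v⟩
    refine Module.Free.of_equiv (LinearEquiv.ofBijective e ⟨?_, ?_⟩)
    · rw [← LinearMap.ker_eq_bot, LinearMap.ker_eq_bot']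
      intro a ha
      exact hinj a (congrArg Subtype.val ha)
    · rintro ⟨w, hw⟩
      obtain ⟨a, rfl⟩ := Submodule.mem_span_singleton.mp hw
      exact ⟨a, rfl⟩

/-- If `𝔪v ⊆ M ⊆ 𝔪F` for some `v ∉ 𝔪F`, then `𝔪v` is a direct summand of `M`. -/
theorem exists_maximalIdeal_summand [IsLocalRing R]
    (hM : ∀ v ∈ M, ∀ i, v i ∈ maximalIdeal R) {v : Fin r → R} {i : Fin r}
    (hv : ∀ z ∈ maximalIdeal R, z • v ∈ M) (hvi : v i ∉ maximalIdeal R) :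
    ∃ N P : Submodule R (Fin r → R), N ⊔ P = M ∧ N ⊓ P = ⊥ ∧
      Nonempty (↥N ≃ₗ[R] ↥(maximalIdeal R)) := by
  obtain ⟨c, hc⟩ := (notMem_maximalIdeal.mp hvi).exists_right_inv
  let φ := LinearMap.toSpanSingleton R (Fin r → R) v
  refine ⟨Submodule.map φ (maximalIdeal R),
    M ⊓ LinearMap.ker (LinearMap.proj (R := R) (φ := fun _ => R) i), ?_, ?_, ?_⟩
  · refine le_antisymm (sup_le ?_ inf_le_left) fun w hw => ?_
    · rintro _ ⟨z, hz, rfl⟩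
      exact hv z hz
    · rw [← add_sub_cancel ((w i * c) • v) w]
      have h1 : w i * c ∈ maximalIdeal R := Ideal.mul_mem_right _ _ (hM w hw i)
      refine Submodule.add_mem_sup ⟨w i * c, h1, rfl⟩ ⟨M.sub_mem hw (hv _ h1), ?_⟩
      rw [SetLike.mem_coe, LinearMap.mem_ker, LinearMap.proj_apply, Pi.sub_apply, Pi.smul_apply,
        smul_eq_mul]
      linear_combination -(w i) * hc
  · rw [eq_bot_iff]
    rintro _ ⟨⟨a, -, rfl⟩, -, hw'⟩
    have h1 : a * v i = 0 := hw'
    have h2 : a = 0 := by linear_combination c * h1 - a * hc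
    simp [h2]
  · refine ⟨(Submodule.equivMapOfInjective φ ?_ _).symm⟩
    rw [← LinearMap.ker_eq_bot, LinearMap.ker_eq_bot']
    intro a ha
    have h1 : a * v i = 0 := congrFun ha i
    linear_combination c * h1 - a * hc

/-- If `Ju ⊆ JM` for a nonzero finitely generated ideal `J`, then `u` is integral over `M`. -/
theorem integralOverMod_of_smul_mem [IsDomain R] {J : Ideal R} (hJ : J ≠ ⊥) (hfg : J.FG)
    {u : Fin r → R} (h : ∀ a ∈ J, a • u ∈ J • M) : IntegralOverMod M u := by
  intro w j hwj hw
  refine memIntClosure_of_mul_mem hJ hfg fun a ha => ?_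
  let φ : (Fin r → R) →ₗ[R] R := Matrix.detRowAlternating.toMultilinearMap.toLinearMap w j
  have hφ : ∀ v, φ v = colDet (Function.update w j v) := fun v =>
    (colDet_eq_detRowAlternating _).symm
  have h1 : φ (a • u) ∈ (J • M).map φ := Submodule.mem_map_of_mem (h a ha)
  rw [Submodule.map_smul'', map_smul, hφ, ← hwj, Function.update_eq_self, smul_eq_mul] at h1
  have h2 : M.map φ ≤ maxMinors M := by
    rintro _ ⟨v, hv, rfl⟩
    refine Ideal.subset_span ⟨Function.update w j v, fun k => ?_, hφ v⟩
    by_cases hk : k = j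
    · subst hk
      simpa using hv
    · simpa [hk] using hw k hk
  have h3 := smul_mono_right J h2 h1
  rwa [smul_eq_mul, smul_eq_mul, mul_comm a, mul_comm J] at h3

theorem pow_smul_sub_mem {x y : R} {I : Ideal R} (hy : y ∈ I) (hx : x ∈ I)
    {P : Module.End R (Fin r → R)} (hP : ∀ u, y • u - x • P u ∈ M) (v : Fin r → R) (k : ℕ) :
    y ^ (k + 1) • v - x ^ (k + 1) • (P ^ (k + 1)) v ∈ I ^ k • M := by
  induction k with
  | zero => simpa using hP v
  | succ k ih =>
    have h1 := Submodule.smul_mem_smul hy ih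
    rw [← Submodule.mul_smul, ← pow_succ'] at h1
    have h2 := Submodule.smul_mem_smul (Ideal.pow_mem_pow hx (k + 1)) (hP ((P ^ (k + 1)) v))
    convert add_mem h1 h2 using 1
    rw [pow_succ' P (k + 1), Module.End.mul_apply]
    module

/-- If `yu - xPu ∈ M` for all `u ∈ F` and `xv ∈ M`, then `y ^ r v ∈ 𝔪 ^ (r - 1) M`, by the
Cayley–Hamilton theorem for `P`. -/
theorem pow_smul_mem [Nontrivial R] {x y : R} {I : Ideal R} (hy : y ∈ I) (hx : x ∈ I) {n : ℕ}
    {M : Submodule R (Fin (n + 1) → R)}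
    {P : Module.End R (Fin (n + 1) → R)} (hP : ∀ u, y • u - x • P u ∈ M) {v : Fin (n + 1) → R}
    (hv : x • v ∈ M) : y ^ (n + 1) • v ∈ I ^ n • M := by
  have hlow : ∀ k < n + 1, x ^ (n + 1) • (P ^ k) v ∈ I ^ n • M := by
    rintro (_ | k) hk
    · have h1 := Submodule.smul_mem_smul (Ideal.pow_mem_pow hx n) hv
      rwa [smul_smul, ← pow_succ] at h1
    · have h1 := Submodule.smul_mem_smul (Ideal.pow_mem_pow hx (n - k))
        (pow_smul_sub_mem hy hx hP v k)
      rw [← Submodule.mul_smul, ← pow_add, Nat.sub_add_cancel (by omega)] at h1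
      have h2 : (x ^ (n - k - 1) * y ^ (k + 1)) • x • v ∈ I ^ n • M := by
        refine Submodule.smul_mem_smul ?_ hv
        have h3 := Ideal.mul_mem_mul (Ideal.pow_mem_pow hx (n - k - 1))
          (Ideal.pow_mem_pow hy (k + 1))
        rwa [← pow_add, show n - k - 1 + (k + 1) = n by omega] at h3
      convert sub_mem h2 h1 using 1
      obtain ⟨m, rfl⟩ : ∃ m, n = k + 1 + m := ⟨n - (k + 1), by omega⟩
      rw [show k + 1 + m - k - 1 = m by omega, show k + 1 + m - k = m + 1 by omega]
      module
  have htop : x ^ (n + 1) • (P ^ (n + 1)) v ∈ I ^ n • M := by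
    obtain ⟨p, hp, hdeg, hPp⟩ : ∃ p : Polynomial R, p.Monic ∧ p.natDegree = n + 1 ∧
        Polynomial.aeval P p = 0 :=
      ⟨P.charpoly, P.charpoly_monic, by simp [LinearMap.charpoly_natDegree],
        P.aeval_self_charpoly⟩
    have h1 := congrArg (fun f : Module.End R (Fin (n + 1) → R) => x ^ (n + 1) • f v) hPp
    simp only [Polynomial.aeval_eq_sum_range, LinearMap.zero_apply, smul_zero] at h1
    rw [Finset.sum_range_succ, hp.coeff_natDegree, one_smul, hdeg, LinearMap.add_apply,
      smul_add] at h1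
    rw [eq_neg_of_add_eq_zero_right h1, LinearMap.sum_apply, Finset.smul_sum]
    refine neg_mem (sum_mem fun k hk => ?_)
    rw [LinearMap.smul_apply, smul_comm]
    exact Submodule.smul_mem _ _ (hlow k (Finset.mem_range.mp hk))
  have h1 := pow_smul_sub_mem hy hx hP v n
  simpa using add_mem h1 htop

/-- A regular system of parameters `x, y` with `M + xF = 𝔪F`, when some maximal minor of `M` lies
outside `𝔪 ^ (r + 1)`. -/
theorem exists_parameters [IsLocalRing R] [Infinite (ResidueField R)]
    (hm : ∃ x y : R, maximalIdeal R = Ideal.span {x, y})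
    (hM : ∀ v ∈ M, ∀ i, v i ∈ maximalIdeal R)
    (hord : ¬ maxMinors M ≤ maximalIdeal R ^ (r + 1)) :
    ∃ x y : R, maximalIdeal R = Ideal.span {x, y} ∧
      ∃ P : Module.End R (Fin r → R), ∀ u, y • u - x • P u ∈ M := by
  obtain ⟨x, y, hxy⟩ := hm
  have hx : x ∈ maximalIdeal R := hxy ▸ Ideal.subset_span (by simp)
  have hy : y ∈ maximalIdeal R := hxy ▸ Ideal.subset_span (by simp)
  rw [maxMinors, Ideal.span_le, Set.not_subset] at hord
  obtain ⟨_, ⟨w, hw, rfl⟩, hdet⟩ := hord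
  have hex : ∀ j i, ∃ a b, a * x + b * y = w j i := fun j i =>
    Ideal.mem_span_pair.mp (hxy ▸ hM _ (hw j) i)
  choose A B hAB using hex
  have hwAB : w = x • A + y • B := by
    funext j i
    simp [← hAB, mul_comm]
  rw [hwAB] at hdet
  obtain ⟨t, ht⟩ := exists_isUnit_colDet hx hy hdet
  refine ⟨x - t * y, y, maximalIdeal_eq_span_sub_mul hxy t, ?_⟩
  let Q : Matrix (Fin r) (Fin r) R := Matrix.of (t • A + B)
  have hQ : IsUnit Q.det := by
    rwa [colDet_eq_detRowAlternating] at ht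
  refine ⟨-((Matrix.of A).vecMulLinear ∘ₗ (Q⁻¹).vecMulLinear), fun u => ?_⟩
  set c := Matrix.vecMul u Q⁻¹ with hc
  have hu : u = Matrix.vecMul c Q := by
    rw [hc, Matrix.vecMul_vecMul, Matrix.nonsing_inv_mul _ hQ, Matrix.vecMul_one]
  have hsum : y • u - (x - t * y) • (-((Matrix.of A).vecMulLinear ∘ₗ (Q⁻¹).vecMulLinear)) u =
      ∑ j, c j • w j := by
    have h1 : (-((Matrix.of A).vecMulLinear ∘ₗ (Q⁻¹).vecMulLinear)) u =
        -(Matrix.vecMul c (Matrix.of A)) := rfl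
    rw [h1]
    nth_rewrite 1 [hu]
    funext i
    simp only [Pi.sub_apply, Pi.smul_apply, Pi.neg_apply, Matrix.vecMul, dotProduct, smul_eq_mul,
      Finset.sum_apply, Q, Matrix.of_apply, Pi.add_apply, hwAB, Finset.mul_sum, mul_neg,
      sub_neg_eq_add]
    rw [← Finset.sum_add_distrib]
    refine Finset.sum_congr rfl fun j _ => ?_
    ring
  rw [hsum]
  exact sum_mem fun j _ => M.smul_mem _ (hw j)

end Submodules

/-- if `K` is an integrally closed `𝔪`-primary ideal of order `r − 1` and
`I = 𝔪K` is the ideal of minors of an integrally closed module `M` of rank `r` without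
free direct summands, then `𝔪` is a direct summand of `M`. -/
theorem statement17 (R : Type*) [CommRing R] [IsLocalRing R]
    (hreg : IsTwoDimRegularLocal R) [Infinite (IsLocalRing.ResidueField R)]
    (r : ℕ) (K : Ideal R) (hKc : IdealIntClosed K) (hKp : IsMPrimary K)
    (hord : ordEQ K (r - 1))
    (M : Submodule R (Fin r → R)) (h1 : FinColength M) (h2 : ModIntClosed M)
    (h3 : ¬ HasFreeSummand M) (h4 : maxMinors M = maximalIdeal R * K) :
    ∃ N P : Submodule R (Fin r → R), N ⊔ P = M ∧ N ⊓ P = ⊥ ∧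
      Nonempty (↥N ≃ₗ[R] ↥(maximalIdeal R)) := by
  have := isDomain_of_isTwoDimRegularLocal hreg
  obtain ⟨_, hdim, hm⟩ := hreg
  have hM : ∀ v ∈ M, ∀ i, v i ∈ maximalIdeal R :=
    fun v hv i => mem_maximalIdeal_of_not_hasFreeSummand h3 hv i
  have hproper : maxMinors M ≠ ⊤ := fun h =>
    (maximalIdeal.isMaximal R).ne_top (top_le_iff.mp (h ▸ h4.le.trans Ideal.mul_le_left))
  obtain ⟨n, rfl⟩ : ∃ n, r = n + 1 :=
    Nat.exists_eq_succ_of_ne_zero (ne_zero_of_maxMinors_ne_top hproper)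
  obtain ⟨f, hfK, hf⟩ := SetLike.not_le_iff_exists.mp hord.2
  rw [Nat.add_sub_cancel] at hf
  have hmf : ∀ z ∈ maximalIdeal R, z * f ∈ maxMinors M := fun z hz =>
    h4 ▸ Ideal.mul_mem_mul hz hfK
  obtain ⟨x, y, hxy, P, hP⟩ := exists_parameters hm hM (by
    intro hle
    obtain ⟨x, y, hxy⟩ := hm
    exact hf (mem_maximalIdeal_pow_of_mul_mem hdim hxy
      (hle (hmf x (hxy ▸ Ideal.subset_span (by simp))))))
  have hx : x ∈ maximalIdeal R := hxy ▸ Ideal.subset_span (by simp)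
  have hy : y ∈ maximalIdeal R := hxy ▸ Ideal.subset_span (by simp)
  have hcolon : ∀ v : Fin (n + 1) → R, x • v ∈ M → ∀ z ∈ maximalIdeal R, z • v ∈ M := by
    intro v hv z hz
    refine h2 _ (integralOverMod_of_smul_mem (J := maximalIdeal R ^ n) ?_
      (IsNoetherian.noetherian _) fun a ha => ?_)
    · refine pow_ne_zero n fun h0 => notMem_span_singleton hdim hxy ?_
      rw [h0] at hy
      rw [show y = 0 by simpa using hy]
      exact zero_mem _
    · have h6 : a * z ∈ maximalIdeal R ^ (n + 1) := by
        rw [pow_succ]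
        exact Ideal.mul_mem_mul ha hz
      obtain ⟨b, hb, c, hc, hbc⟩ := Submodule.mem_sup.mp (maximalIdeal_pow_succ_le hxy n h6)
      obtain ⟨g, hg, rfl⟩ := Ideal.mem_span_singleton_mul.mp hb
      obtain ⟨s, rfl⟩ := Ideal.mem_span_singleton'.mp hc
      rw [smul_smul, ← hbc, add_smul, mul_comm x g, mul_smul, mul_smul]
      exact add_mem (Submodule.smul_mem_smul hg hv)
        (Submodule.smul_mem _ _ (pow_smul_mem hy hx hP hv))
  suffices h : ∃ v : Fin (n + 1) → R, x • v ∈ M ∧ ∃ i, v i ∉ maximalIdeal R by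
    obtain ⟨v, hv, i, hvi⟩ := h
    exact exists_maximalIdeal_summand hM (hcolon v hv) hvi
  by_contra! hcon
  let g : Module.End R (Fin (n + 1) → R) := y • LinearMap.id - x • P
  have hg : ∀ u, g u ∈ M := hP
  have hgI : ∀ u i, g u i ∈ maximalIdeal R := fun u => hM _ (hg u)
  have hdecomp : ∀ z ∈ M, ∃ q v, (∀ i, v i ∈ maximalIdeal R ^ 2) ∧ z = g q + v := by
    intro z hz
    have hex : ∀ i, ∃ a b, a * x + b * y = z i := fun i =>
      Ideal.mem_span_pair.mp (hxy ▸ hM z hz i)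
    choose p q hpq using hex
    have hz' : z = g q + x • (p + P q) := by
      funext i
      simp only [g, LinearMap.sub_apply, LinearMap.smul_apply, LinearMap.id_apply, Pi.add_apply,
        Pi.sub_apply, Pi.smul_apply, smul_eq_mul, ← hpq]
      ring
    refine ⟨q, x • (p + P q), fun i => ?_, hz'⟩
    have h6 : x • (p + P q) ∈ M := by
      rw [← sub_eq_iff_eq_add'.mpr hz']
      exact M.sub_mem hz (hg q)
    rw [sq]
    exact Ideal.mul_mem_mul hx (hcon _ h6 i)
  have hle : maxMinors M ≤ Ideal.span {LinearMap.det g} ⊔ maximalIdeal R ^ (n + 1 + 1) := by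
    rw [maxMinors, Ideal.span_le]
    rintro _ ⟨w, hw, rfl⟩
    choose q v hv hwq using fun j => hdecomp (w j) (hw j)
    rw [show w = fun j => g (q j) + v j from funext hwq]
    exact colDet_mem_span_det_sup g hgI hv
  refine hf (mem_maximalIdeal_pow_of_mul_mem_span_sup hdim hxy ?_ fun z hz => hle (hmf z hz))
  have hdet : LinearMap.det g = colDet fun j => g (Pi.single j 1) := by
    rw [← LinearMap.det_toMatrix', colDet]
    congr 1
  have h6 := colDet_mem_pow_sum (I := maximalIdeal R) (n := fun _ => 1)
    (w := fun j => g (Pi.single j 1)) (by simpa using fun j i => hgI (Pi.single j 1) i)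
  simpa [hdet] using h6
end
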